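/- arXiv:2111.14986 — 3 statements merged into one kernel-verified Lean document; each statement's English description precedes it below -/
import Mathlib

section
/- Let k be a positive integer and let G be a finite simple graph that is k-degenerate. If k is odd, then the minimum size f(G) of a feedback vertex set of G satisfies f(G) ≤ ((k−1)/(k+1))·n(G), and if k is even, then f(G) ≤ (k/(k+2))·n(G). -/
/-- A simple graph is `k`-degenerate if every nonempty (induced) subgraph has a
vertex of degree at most `k`. -/
def Degenerate {V : Type*} (G : SimpleGraph V) (k : ℕ) : Prop :=
  ∀ s : Set V, s.Nonempty → ∃ v ∈ s, (s ∩ G.neighborSet v).ncard ≤ k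

/-- `fvsNum G` is the minimum size of a feedback vertex set of `G`, i.e. of a set `F`
of vertices such that `G - F` has no cycle. -/
noncomputable def fvsNum {V : Type*} [Fintype V] (G : SimpleGraph V) : ℕ :=
  sInf {n | ∃ F : Set V, (G.induce Fᶜ).IsAcyclic ∧ F.ncard = n}

theorem acyclic_of_one {V : Type*} [Fintype V] (G : SimpleGraph V) (A : Set V)
    (h : ∀ t : Set V, t ⊆ A → t.Nonempty → ∃ v ∈ t, (t ∩ G.neighborSet v).ncard ≤ 1) :
    (G.induce A).IsAcyclic := by
  classical
  intro u p hp
  obtain ⟨v, hv, hle⟩ := h (Subtype.val '' {w | w ∈ p.support})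
    (by rintro _ ⟨w, _, rfl⟩; exact w.2) ⟨u, u, p.start_mem_support, rfl⟩
  obtain ⟨w, hw, rfl⟩ := hv
  have h2 := hp.ncard_neighborSet_toSubgraph_eq_two hw
  have hsub : Subtype.val '' (p.toSubgraph.neighborSet w) ⊆
      (Subtype.val '' {w | w ∈ p.support}) ∩ G.neighborSet w.1 := by
    rintro _ ⟨x, hx, rfl⟩
    have hx' : p.toSubgraph.Adj w x := hx
    refine ⟨⟨x, ?_, rfl⟩, ?_⟩
    · have := hx'.snd_mem
      simpa using this
    · exact hx'.adj_sub
  have h3 := Set.ncard_le_ncard hsub (Set.toFinite _)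
  rw [Set.ncard_image_of_injective _ Subtype.val_injective] at h3
  omega

theorem exists_coloring {V : Type*} [Fintype V] (G : SimpleGraph V) (k m : ℕ)
    (hkm : k < 2 * m) (hdeg : Degenerate G k) (s : Finset V) :
    ∃ c : V → Fin m, ∀ i, ∀ t : Set V, t ⊆ {v | v ∈ s ∧ c v = i} → t.Nonempty →
      ∃ v ∈ t, (t ∩ G.neighborSet v).ncard ≤ 1 := by
  classical
  induction s using Finset.strongInduction with
  | H s ih =>
    rcases s.eq_empty_or_nonempty with rfl | hs
    · refine ⟨fun _ => ⟨0, by omega⟩, ?_⟩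
      rintro i t ht ⟨x, hx⟩
      simpa using (ht hx).1
    · obtain ⟨v, hv, hvk⟩ := hdeg (s : Set V) (by simpa using hs)
      have hv' : v ∈ s := by simpa using hv
      obtain ⟨c, hc⟩ := ih (s.erase v) (Finset.erase_ssubset hv')
      have hi : ∃ i : Fin m, ((s.filter (fun w => G.Adj v w)).filter (fun w => c w = i)).card ≤ 1 := by
        by_contra! hcon
        have h1 := Finset.card_eq_sum_card_fiberwise (f := c) (s := s.filter (fun w => G.Adj v w))
          (t := Finset.univ) (fun _ _ => by simp)
        have h2 : ∑ i : Fin m, 2 ≤ ∑ i : Fin m,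
            ((s.filter (fun w => G.Adj v w)).filter (fun w => c w = i)).card :=
          Finset.sum_le_sum (fun i _ => hcon i)
        have h3 : ((s : Set V) ∩ G.neighborSet v) = ((s.filter (fun w => G.Adj v w) : Finset V) : Set V) := by
          ext w; simp
        rw [h3, Set.ncard_coe_finset] at hvk
        simp at h2
        omega
      obtain ⟨i, hi⟩ := hi
      refine ⟨Function.update c v i, ?_⟩
      intro j t ht hne
      by_cases hvt : v ∈ t
      · refine ⟨v, hvt, le_trans ?_ hi⟩
        rw [← Set.ncard_coe_finset]
        apply Set.ncard_le_ncard _ (Set.toFinite _)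
        rintro w ⟨hwt, hw⟩
        have hw' : G.Adj v w := hw
        have h1 := ht hwt
        have h2 := ht hvt
        have hne : w ≠ v := hw'.ne'
        simp [hne] at h1 h2
        simp [h1, h2, hw']
      · apply hc j t _ hne
        intro w hw
        have hne : w ≠ v := fun h => hvt (h ▸ hw)
        have h1 := ht hw
        simp [hne] at h1
        simp [hne, h1]

theorem fvs_main {V : Type*} [Fintype V] (G : SimpleGraph V) (k m : ℕ)
    (hkm : k < 2 * m) (hdeg : Degenerate G k) :
    (fvsNum G : ℚ) ≤ ((m : ℚ) - 1) / m * Fintype.card V := by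
  classical
  obtain ⟨c, hc⟩ := exists_coloring G k m hkm hdeg Finset.univ
  have hm : 0 < m := by omega
  obtain ⟨i, hi⟩ : ∃ i : Fin m, Fintype.card V ≤ m * (Finset.univ.filter (fun w => c w = i)).card := by
    by_contra! hcon
    have h1 := Finset.card_eq_sum_card_fiberwise (f := c) (s := (Finset.univ : Finset V))
      (t := Finset.univ) (fun _ _ => by simp)
    have h2 : ∑ i : Fin m, m * (Finset.univ.filter (fun w => c w = i)).card
        < ∑ i : Fin m, Fintype.card V :=
      Finset.sum_lt_sum_of_nonempty ⟨⟨0, hm⟩, by simp⟩ (fun i _ => hcon i)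
    rw [← Finset.mul_sum, ← h1] at h2
    simp at h2
  set A := Finset.univ.filter (fun w => c w = i) with hA
  have hac : (G.induce (A : Set V)).IsAcyclic := by
    apply acyclic_of_one
    intro t ht
    apply hc i t
    intro w hw
    have := ht hw
    simpa [hA] using this
  have hle : fvsNum G ≤ Aᶜ.card := by
    apply Nat.sInf_le
    refine ⟨((A : Set V))ᶜ, ?_, ?_⟩
    · rw [compl_compl]; exact hac
    · rw [← Finset.coe_compl, Set.ncard_coe_finset]
  have hsum := Finset.card_add_card_compl A
  have hsum' : (A.card : ℚ) + Aᶜ.card = Fintype.card V := by exact_mod_cast hsum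
  have hle' : (fvsNum G : ℚ) ≤ Aᶜ.card := by exact_mod_cast hle
  have hi' : (Fintype.card V : ℚ) ≤ m * A.card := by exact_mod_cast hi
  have hm' : (0 : ℚ) < m := by exact_mod_cast hm
  rw [div_mul_eq_mul_div, le_div_iff₀ hm']
  nlinarith

theorem stmt0 {V : Type*} [Fintype V] (k : ℕ) (hk : 1 ≤ k) (G : SimpleGraph V)
    (hdeg : Degenerate G k) :
    (Odd k → (fvsNum G : ℚ) ≤ ((k : ℚ) - 1) / ((k : ℚ) + 1) * Fintype.card V) ∧
    (Even k → (fvsNum G : ℚ) ≤ (k : ℚ) / ((k : ℚ) + 2) * Fintype.card V) := by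
  constructor
  · rintro ⟨r, rfl⟩
    have h := fvs_main G _ (r + 1) (by omega) hdeg
    convert h using 2
    push_cast
    field_simp
    ring
  · rintro ⟨r, rfl⟩
    have h := fvs_main G _ (r + 1) (by omega) hdeg
    convert h using 2
    push_cast
    field_simp
    ring
end

section
/- For every even integer k ≥ 2 and every natural number i, there exists a finite simple graph G_i that is k-degenerate, has exactly (3k+6)/2 + i·(3k+4)/2 vertices, and whose minimum feedback vertex set has size exactly (i+1)·(3k−2)/2. -/
/-- `Back m u v`: `u` is an earlier neighbour of `v`. Let `p = 3m+2`. Ordinary vertices are joined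
to the `2m` preceding vertices; multiples of `p` are joined to the `m` preceding vertices and
to the vertices at distance `2m+2, …, 3m+1` before. -/
def Back (m u v : ℕ) : Prop :=
  u < v ∧ ((v % (3 * m + 2) = 0 ∧ (v ≤ u + m ∨ (u + 2 * m + 2 ≤ v ∧ v ≤ u + 3 * m + 1))) ∨
    (v % (3 * m + 2) ≠ 0 ∧ v ≤ u + 2 * m))

/-- The extremal graph on `N` vertices. -/
def chainGraph (m N : ℕ) : SimpleGraph (Fin N) where
  Adj a b := Back m a b ∨ Back m b a
  symm := ⟨fun _ _ h => h.symm⟩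
  loopless := ⟨fun _ h => by rcases h with h | h <;> exact absurd h.1 (lt_irrefl _)⟩

theorem acyclic_of_order {V : Type*} (G : SimpleGraph V) (f : V → ℕ) (hf : Function.Injective f)
    (h : ∀ v a b, G.Adj v a → G.Adj v b → f a < f v → f b < f v → a = b) : G.IsAcyclic := by
  classical
  intro u c hc
  obtain ⟨v, hv, hmax⟩ := c.support.toFinset.exists_max_image f ⟨u, by simp⟩
  have hv' : v ∈ c.support := by simpa using hv
  set d := c.rotate v hv' with hd
  have hdc : d.IsCycle := (SimpleGraph.Walk.isCycle_rotate hv').2 hc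
  have hn : ¬ d.Nil := hdc.not_nil
  have key : ∀ w ∈ d.support, f w ≤ f v := by
    intro w hw
    apply hmax
    rw [hd, SimpleGraph.Walk.mem_support_rotate_iff] at hw
    simpa using hw
  have a1 := d.adj_snd hn
  have a2 := (d.adj_penultimate hn).symm
  refine hdc.snd_ne_penultimate (h v _ _ a1 a2 ?_ ?_)
  · exact lt_of_le_of_ne (key _ (d.getVert_mem_support _)) (fun e => a1.ne (hf e).symm)
  · exact lt_of_le_of_ne (key _ (d.getVert_mem_support _)) (fun e => a2.ne (hf e).symm)

theorem no_triangle {V : Type*} {G : SimpleGraph V} (h : G.IsAcyclic) {a b c : V}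
    (h1 : G.Adj a b) (h2 : G.Adj b c) (h3 : G.Adj c a) : False := by
  refine h (SimpleGraph.Walk.cons h1 (SimpleGraph.Walk.cons h2 (SimpleGraph.Walk.cons h3 .nil))) ?_
  have := h1.ne; have := h2.ne; have := h3.ne
  simp [SimpleGraph.Walk.cons_isCycle_iff, SimpleGraph.Walk.cons_isPath_iff]
  grind

theorem no_square {V : Type*} {G : SimpleGraph V} (h : G.IsAcyclic) {a b c d : V}
    (h1 : G.Adj a b) (h2 : G.Adj b c) (h3 : G.Adj c d) (h4 : G.Adj d a)
    (hac : a ≠ c) (hbd : b ≠ d) : False := by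
  refine h (SimpleGraph.Walk.cons h1 (SimpleGraph.Walk.cons h2
    (SimpleGraph.Walk.cons h3 (SimpleGraph.Walk.cons h4 .nil)))) ?_
  have := h1.ne; have := h2.ne; have := h3.ne; have := h4.ne
  simp [SimpleGraph.Walk.cons_isCycle_iff, SimpleGraph.Walk.cons_isPath_iff]
  grind

theorem chain_degenerate (m N : ℕ) : Degenerate (chainGraph m N) (2 * m) := by
  classical
  intro s hs
  obtain ⟨v, hv, hmax⟩ := s.toFinite.exists_maximalFor id s hs
  have hmax' : ∀ u ∈ s, u ≤ v := by
    intro u hu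
    rcases le_total u v with h | h
    · exact h
    · exact hmax hu h
  refine ⟨v, hv, ?_⟩
  let T : Finset ℕ := if (v : ℕ) % (3 * m + 2) = 0 then
    Finset.Icc 1 m ∪ Finset.Icc (2 * m + 2) (3 * m + 1) else Finset.Icc 1 (2 * m)
  have hT : T.card ≤ 2 * m := by
    simp only [T]
    split_ifs
    · refine (Finset.card_union_le _ _).trans ?_
      simp; try omega
    · simp
  have : (s ∩ (chainGraph m N).neighborSet v).ncard ≤ (T : Set ℕ).ncard := by
    apply Set.ncard_le_ncard_of_injOn (fun u : Fin N => (v : ℕ) - u)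
    · rintro u ⟨hu, hadj⟩
      have h1 : (u : ℕ) ≤ v := hmax' u hu
      have hadj : Back m v u ∨ Back m u v := hadj
      unfold Back at hadj
      simp only [T]
      split_ifs with h
      · simp; omega
      · simp; omega
    · rintro u ⟨hu, -⟩ w ⟨hw, -⟩ he
      have h1 : (u : ℕ) ≤ v := hmax' u hu
      have h2 : (w : ℕ) ≤ v := hmax' w hw
      ext
      simp only at he
      omega
  rw [Set.ncard_coe_finset] at this
  omega

theorem exists_four (T : Finset ℕ) (h : 4 ≤ T.card) :
    ∃ a ∈ T, ∃ b ∈ T, ∃ c ∈ T, ∃ d ∈ T, a < b ∧ b < c ∧ c < d := by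
  let e := T.orderEmbOfCardLe h
  refine ⟨e 0, T.orderEmbOfCardLe_mem h 0, e 1, T.orderEmbOfCardLe_mem h 1,
    e 2, T.orderEmbOfCardLe_mem h 2, e 3, T.orderEmbOfCardLe_mem h 3, ?_, ?_, ?_⟩ <;>
  exact e.strictMono (by decide)

theorem exists_three (T : Finset ℕ) (h : 3 ≤ T.card) :
    ∃ a ∈ T, ∃ b ∈ T, ∃ c ∈ T, a < b ∧ b < c := by
  let e := T.orderEmbOfCardLe h
  refine ⟨e 0, T.orderEmbOfCardLe_mem h 0, e 1, T.orderEmbOfCardLe_mem h 1,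
    e 2, T.orderEmbOfCardLe_mem h 2, ?_, ?_⟩ <;>
  exact e.strictMono (by decide)

theorem exists_five (T : Finset ℕ) (h : 5 ≤ T.card) :
    ∃ a ∈ T, ∃ b ∈ T, ∃ c ∈ T, ∃ d ∈ T, ∃ f ∈ T, a < b ∧ b < c ∧ c < d ∧ d < f := by
  let e := T.orderEmbOfCardLe h
  refine ⟨e 0, T.orderEmbOfCardLe_mem h 0, e 1, T.orderEmbOfCardLe_mem h 1,
    e 2, T.orderEmbOfCardLe_mem h 2, e 3, T.orderEmbOfCardLe_mem h 3,
    e 4, T.orderEmbOfCardLe_mem h 4, ?_, ?_, ?_, ?_⟩ <;>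
  exact e.strictMono (by decide)

theorem mod_ne {p j x : ℕ} (h1 : j * p < x) (h2 : x < (j + 1) * p) : x % p ≠ 0 := by
  intro h
  obtain ⟨q, rfl⟩ := Nat.dvd_of_mod_eq_zero h
  rw [mul_comm p q] at h1 h2
  have a := lt_of_mul_lt_mul_right h1 (Nat.zero_le p)
  have b := lt_of_mul_lt_mul_right h2 (Nat.zero_le p)
  omega

theorem card_bound (m : ℕ) (S : Finset ℕ)
    (H3 : ∀ a ∈ S, ∀ b ∈ S, ∀ c ∈ S, Back m a b → Back m b c → Back m a c → False)
    (H4 : ∀ a ∈ S, ∀ b ∈ S, ∀ c ∈ S, ∀ d ∈ S,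
      Back m a b → Back m b c → Back m c d → Back m a d → False) (j : ℕ) :
    (S.filter (· ≤ j * (3 * m + 2))).card ≤ 3 * j + 1 ∧
    ((∀ x ∈ S, x ≤ j * (3 * m + 2) → x + m < j * (3 * m + 2)) →
      (S.filter (· ≤ j * (3 * m + 2))).card ≤ 3 * j) := by
  induction j with
  | zero =>
    have hsub : S.filter (· ≤ 0 * (3 * m + 2)) ⊆ {0} := by
      intro x hx; simp at hx ⊢; exact hx.2
    constructor
    · simpa using Finset.card_le_card hsub
    · intro h
      have : S.filter (· ≤ 0 * (3 * m + 2)) = ∅ := by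
        apply Finset.filter_eq_empty_iff.2
        intro x hx hx'
        have := h x hx hx'
        omega
      rw [this]; simp
  | succ j ih =>
    obtain ⟨ih1, ih2⟩ := ih
    have hm1 : ∀ x, j * (3 * m + 2) < x → x < (j + 1) * (3 * m + 2) → x % (3 * m + 2) ≠ 0 :=
      fun x h1 h2 => mod_ne h1 h2
    have hm2 : ((j + 1) * (3 * m + 2)) % (3 * m + 2) = 0 := Nat.mul_mod_left _ _
    have hb : (j + 1) * (3 * m + 2) = j * (3 * m + 2) + 3 * m + 2 := by ring
    rw [hb] at hm1 hm2 ⊢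
    generalize hB : j * (3 * m + 2) = B at *
    set T := S.filter (fun x => B < x ∧ x ≤ B + 3 * m + 2) with hT
    have hmem : ∀ x ∈ T, x ∈ S ∧ B < x ∧ x ≤ B + 3 * m + 2 := by
      intro x hx; simpa [hT] using hx
    have hsplit : (S.filter (· ≤ B + 3 * m + 2)).card = (S.filter (· ≤ B)).card + T.card := by
      rw [← Finset.card_union_of_disjoint]
      · congr 1
        ext x
        simp only [hT, Finset.mem_filter, Finset.mem_union]
        constructor
        · rintro ⟨h1, h2⟩
          by_cases h : x ≤ B
          · exact Or.inl ⟨h1, h⟩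
          · exact Or.inr ⟨h1, by omega, h2⟩
        · rintro (⟨h1, h2⟩ | ⟨h1, h2, h3⟩)
          · exact ⟨h1, by omega⟩
          · exact ⟨h1, h3⟩
      · rw [Finset.disjoint_left]
        intro x h1 h2
        simp only [hT, Finset.mem_filter] at h1 h2
        omega
    -- back-adjacency for ordinary vertices
    have hord : ∀ u v, B < v → v < B + 3 * m + 2 → u < v → v ≤ u + 2 * m → Back m u v :=
      fun u v h1 h2 h3 h4 => ⟨h3, Or.inr ⟨hm1 v h1 h2, h4⟩⟩
    have htop : ∀ u, u < B + 3 * m + 2 → (B + 3 * m + 2 ≤ u + m ∨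
        (u ≤ B + m ∧ B < u)) → Back m u (B + 3 * m + 2) :=
      fun u h1 h2 => ⟨h1, Or.inl ⟨hm2, by omega⟩⟩
    have gap : ∀ x ∈ T, ∀ y ∈ T, ∀ z ∈ T, x < y → y < z → z < B + 3 * m + 2 →
        x + 2 * m < z := by
      intro x hx y hy z hz hxy hyz hzt
      by_contra hcon
      obtain ⟨x1, x2, x3⟩ := hmem x hx
      obtain ⟨y1, y2, y3⟩ := hmem y hy
      obtain ⟨z1, z2, z3⟩ := hmem z hz
      exact H3 x x1 y y1 z z1 (hord _ _ (by omega) (by omega) (by omega) (by omega))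
        (hord _ _ (by omega) (by omega) (by omega) (by omega))
        (hord _ _ (by omega) (by omega) (by omega) (by omega))
    have four : ∀ x ∈ T, ∀ y ∈ T, ∀ z ∈ T, ∀ w ∈ T, x < y → y < z → z < w →
        w < B + 3 * m + 2 := by
      intro x hx y hy z hz w hw hxy hyz hzw
      by_contra hcon
      obtain ⟨x1, x2, x3⟩ := hmem x hx
      obtain ⟨y1, y2, y3⟩ := hmem y hy
      obtain ⟨z1, z2, z3⟩ := hmem z hz
      obtain ⟨w1, w2, w3⟩ := hmem w hw
      have hg := gap x hx y hy z hz hxy hyz (by omega)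
      have hw' : w = B + 3 * m + 2 := by omega
      subst hw'
      by_cases c1 : y ≤ B + m
      · exact H3 x x1 y y1 _ w1 (hord _ _ (by omega) (by omega) (by omega) (by omega))
          (htop _ (by omega) (by omega)) (htop _ (by omega) (by omega))
      by_cases c2 : B + 3 * m + 2 ≤ y + m
      · exact H3 y y1 z z1 _ w1 (hord _ _ (by omega) (by omega) (by omega) (by omega))
          (htop _ (by omega) (by omega)) (htop _ (by omega) (by omega))
      exact H4 x x1 y y1 z z1 _ w1 (hord _ _ (by omega) (by omega) (by omega) (by omega))
          (hord _ _ (by omega) (by omega) (by omega) (by omega))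
          (htop _ (by omega) (by omega)) (htop _ (by omega) (by omega))
    have hT4 : T.card ≤ 4 := by
      by_contra hcon
      obtain ⟨a, ha, b, hb', c, hc, d, hd, f, hf, h1, h2, h3, h4⟩ := exists_five T (by omega)
      have h5 := four b hb' c hc d hd f hf h2 h3 h4
      have h6 := gap a ha b hb' c hc h1 h2 (by omega)
      have h7 := gap c hc d hd f hf h3 h4 (by omega)
      have := hmem a ha
      omega
    rw [hsplit]
    constructor
    · by_cases h : T.card ≤ 3
      · omega
      obtain ⟨a, ha, b, hb', c, hc, d, hd, h1, h2, h3⟩ := exists_four T (by omega)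
      have h5 := four a ha b hb' c hc d hd h1 h2 h3
      have h7 := gap b hb' c hc d hd h2 h3 (by omega)
      have hA := hmem a ha
      have hB' := hmem b hb'
      have := ih2 (by
        intro x hx hxB
        by_contra hcon
        exact H3 x hx a hA.1 b hB'.1 (hord _ _ (by omega) (by omega) (by omega) (by omega))
          (hord _ _ (by omega) (by omega) (by omega) (by omega))
          (hord _ _ (by omega) (by omega) (by omega) (by omega)))
      omega
    · intro hW
      have hT2 : T.card ≤ 2 := by
        by_contra hcon
        obtain ⟨a, ha, b, hb', c, hc, h1, h2⟩ := exists_three T (by omega)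
        have hA := hmem a ha
        have hC := hmem c hc
        have h3 := hW c hC.1 hC.2.2
        have h4 := gap a ha b hb' c hc h1 h2 (by omega)
        omega
      omega

/-- The vertices of a long induced path in the graph. -/
def pathVtx (m l : ℕ) : ℕ := l * (m + 1) - (l / 3 + 1)

theorem pathVtx_step (m : ℕ) (hm : 1 ≤ m) (l : ℕ) : pathVtx m l < pathVtx m (l + 1) := by
  unfold pathVtx
  have : (l + 1) * (m + 1) = l * (m + 1) + (m + 1) := by ring
  have h2 : l * 2 ≤ l * (m + 1) := Nat.mul_le_mul_left _ (by omega)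
  rw [this]
  omega

theorem pathVtx_two (m : ℕ) (hm : 1 ≤ m) (l : ℕ) : pathVtx m l + 2 * m < pathVtx m (l + 2) := by
  unfold pathVtx
  have : (l + 2) * (m + 1) = l * (m + 1) + 2 * (m + 1) := by ring
  have h2 : l * 2 ≤ l * (m + 1) := Nat.mul_le_mul_left _ (by omega)
  rw [this]
  omega

theorem pathVtx_mono (m : ℕ) (hm : 1 ≤ m) : StrictMono (pathVtx m) :=
  strictMono_nat_of_lt_succ (pathVtx_step m hm)

theorem pathVtx_mod (m : ℕ) (hm : 1 ≤ m) (l : ℕ) (hl : 1 ≤ l) :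
    pathVtx m l % (3 * m + 2) ≠ 0 := by
  have hdm := Nat.div_add_mod (l - 1) 3
  have hr : (l - 1) % 3 < 3 := Nat.mod_lt _ (by norm_num)
  set q := (l - 1) / 3 with hq
  set r := (l - 1) % 3 with hr'
  have hl' : l = 3 * q + r + 1 := by omega
  apply mod_ne (j := q)
  all_goals
    unfold pathVtx
    have e1 : (q + 1) * (3 * m + 2) = q * (3 * m + 2) + 3 * m + 2 := by ring
    have e2 : l * (m + 1) = q * (3 * m + 2) + q + (r + 1) * (m + 1) := by rw [hl']; ring
    rw [e2]
    try rw [e1]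
    generalize q * (3 * m + 2) = B
    have : r = 0 ∨ r = 1 ∨ r = 2 := by omega
    rcases this with h | h | h <;> rw [h] <;> omega

theorem path_acyclic (m N : ℕ) (hm : 1 ≤ m) (F : Set (Fin N))
    (hF : ∀ x : Fin N, x ∈ Fᶜ → ∃ l, (x : ℕ) = pathVtx m l) :
    ((chainGraph m N).induce Fᶜ).IsAcyclic := by
  apply acyclic_of_order ((chainGraph m N).induce Fᶜ)
    (fun x : (Fᶜ : Set (Fin N)) => (x.1 : ℕ))
  · intro x y h
    exact Subtype.ext (Fin.ext h)
  · rintro ⟨v, hv⟩ ⟨a, ha⟩ ⟨b, hb⟩ h1 h2 h3 h4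
    simp only at h3 h4
    have key : ∀ c : Fin N, c ∈ Fᶜ → (chainGraph m N).Adj v c → (c : ℕ) < v →
        ∀ l, (v : ℕ) = pathVtx m l → 1 ≤ l ∧ (c : ℕ) = pathVtx m (l - 1) := by
      intro c hc hadj hlt l hl
      obtain ⟨l', hl'⟩ := hF c hc
      have hll : l' < l := by
        rw [hl, hl'] at hlt
        exact (pathVtx_mono m hm).lt_iff_lt.1 hlt
      have hmod := pathVtx_mod m hm l (by omega)
      have hadj : Back m v c ∨ Back m c v := hadj
      have hle : (v : ℕ) ≤ c + 2 * m := by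
        unfold Back at hadj
        rw [← hl] at hmod
        omega
      refine ⟨by omega, ?_⟩
      by_contra hne
      have h5 : l' + 2 ≤ l := by
        have : l' ≠ l - 1 := by rintro rfl; exact hne hl'
        omega
      have h6 := pathVtx_two m hm l'
      have h7 := (pathVtx_mono m hm).monotone h5
      omega
    obtain ⟨l, hl⟩ := hF v hv
    have e1 := key a ha h1 h3 l hl
    have e2 := key b hb h2 h4 l hl
    exact Subtype.ext (Fin.ext (e1.2.trans e2.2.symm))

theorem forest_bound (m j N : ℕ) (hN : N = j * (3 * m + 2) + 1) (F : Set (Fin N))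
    (h : ((chainGraph m N).induce Fᶜ).IsAcyclic) : Fᶜ.ncard ≤ 3 * j + 1 := by
  classical
  set S : Finset ℕ := 
    Finset.image Fin.val (Finset.univ.filter (fun x : Fin N => x ∈ Fᶜ)) with hS
  have hmem : ∀ a ∈ S, ∃ x : Fin N, ∃ _ : x ∈ Fᶜ, (x : ℕ) = a := by
    intro a ha
    simp only [hS, Finset.mem_image, Finset.mem_filter] at ha
    obtain ⟨x, hx, rfl⟩ := ha
    exact ⟨x, hx.2, rfl⟩
  have adj : ∀ {x y : Fin N} (hx : x ∈ Fᶜ) (hy : y ∈ Fᶜ), Back m x y →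
      ((chainGraph m N).induce Fᶜ).Adj ⟨x, hx⟩ ⟨y, hy⟩ := fun _ _ hb => Or.inl hb
  have hb := card_bound m S
    (by
      intro a ha b hb c hc h1 h2 h3
      obtain ⟨x, hx, rfl⟩ := hmem a ha
      obtain ⟨y, hy, rfl⟩ := hmem b hb
      obtain ⟨z, hz, rfl⟩ := hmem c hc
      exact no_triangle h (adj hx hy h1) (adj hy hz h2) (adj hx hz h3).symm)
    (by
      intro a ha b hb c hc d hd h1 h2 h3 h4
      obtain ⟨x, hx, rfl⟩ := hmem a ha
      obtain ⟨y, hy, rfl⟩ := hmem b hb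
      obtain ⟨z, hz, rfl⟩ := hmem c hc
      obtain ⟨w, hw, rfl⟩ := hmem d hd
      refine no_square h (adj hx hy h1) (adj hy hz h2) (adj hz hw h3) (adj hx hw h4).symm ?_ ?_
      · intro e
        have : (x : ℕ) = z := congrArg (fun t => ((t : (Fᶜ : Set (Fin N))).1 : ℕ)) e
        have := h1.1; have := h2.1; omega
      · intro e
        have : (y : ℕ) = w := congrArg (fun t => ((t : (Fᶜ : Set (Fin N))).1 : ℕ)) e
        have := h3.1; have := h2.1; omega) j
  have h1 : S.filter (· ≤ j * (3 * m + 2)) = S := by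
    apply Finset.filter_true_of_mem
    intro a ha
    obtain ⟨x, -, rfl⟩ := hmem a ha
    have := x.2
    omega
  rw [h1] at hb
  have h2 : S.card = Fᶜ.ncard := by
    rw [hS, Finset.card_image_of_injective _ Fin.val_injective, ← Set.ncard_coe_finset]
    congr 1
    ext x
    simp
  omega

theorem chain_fvs (m j : ℕ) (hm : 1 ≤ m) :
    fvsNum (chainGraph m (j * (3 * m + 2) + 1)) = j * (3 * m - 1) := by
  classical
  set N := j * (3 * m + 2) + 1 with hN
  have hcount : N = j * (3 * m - 1) + (3 * j + 1) := by
    have : 3 * m + 2 = (3 * m - 1) + 3 := by omega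
    rw [hN, this]; ring
  have hlow : ∀ F : Set (Fin N), ((chainGraph m N).induce Fᶜ).IsAcyclic →
      j * (3 * m - 1) ≤ F.ncard := by
    intro F hF
    have h1 := forest_bound m j N hN F hF
    have h2 := Set.ncard_add_ncard_compl F
    rw [Nat.card_eq_fintype_card, Fintype.card_fin] at h2
    omega
  have hlt : ∀ l : Fin (3 * j + 1), pathVtx m l < N := by
    intro l
    have h1 := (pathVtx_mono m hm).monotone (show (l : ℕ) ≤ 3 * j by omega)
    have h2 : pathVtx m (3 * j) ≤ j * (3 * m + 2) := by
      unfold pathVtx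
      have : 3 * j * (m + 1) = j * (3 * m + 2) + j := by ring
      rw [this]
      omega
    omega
  let g : Fin (3 * j + 1) → Fin N := fun l => ⟨pathVtx m l, hlt l⟩
  have hg : Function.Injective g := by
    intro a b hab
    have : pathVtx m a = pathVtx m b := congrArg Fin.val hab
    exact Fin.ext ((pathVtx_mono m hm).injective this)
  have hcard : (Set.range g).ncard = 3 * j + 1 := by
    rw [← Set.image_univ, Set.ncard_image_of_injective _ hg, Set.ncard_univ]
    simp
  have hac : ((chainGraph m N).induce ((Set.range g)ᶜ)ᶜ).IsAcyclic := by
    apply path_acyclic m N hm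
    intro x hx
    rw [compl_compl] at hx
    obtain ⟨l, rfl⟩ := hx
    exact ⟨l, rfl⟩
  have hF : ((Set.range g)ᶜ).ncard = j * (3 * m - 1) := by
    have h2 := Set.ncard_add_ncard_compl (Set.range g)
    rw [Nat.card_eq_fintype_card, Fintype.card_fin] at h2
    omega
  apply le_antisymm
  · exact Nat.sInf_le ⟨_, hac, hF⟩
  · apply le_csInf
    · exact ⟨_, _, hac, hF⟩
    · rintro n ⟨F, hF1, rfl⟩
      exact hlow F hF1

theorem stmt3 (k : ℕ) (hk : 2 ≤ k) (hke : Even k) (i : ℕ) :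
    ∃ G : SimpleGraph (Fin ((3 * k + 6) / 2 + i * ((3 * k + 4) / 2))),
      Degenerate G k ∧ fvsNum G = (i + 1) * ((3 * k - 2) / 2) := by
  obtain ⟨m, hm⟩ := hke
  have h1 : (3 * k + 6) / 2 + i * ((3 * k + 4) / 2) = (i + 1) * (3 * m + 2) + 1 := by
    have e1 : (3 * k + 6) / 2 = 3 * m + 3 := by omega
    have e2 : (3 * k + 4) / 2 = 3 * m + 2 := by omega
    rw [e1, e2]; ring
  have h2 : (3 * k - 2) / 2 = 3 * m - 1 := by omega
  have h3 : k = 2 * m := by omega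
  rw [h1, h2, h3]
  exact ⟨chainGraph m _, chain_degenerate m _, chain_fvs m (i + 1) (by omega)⟩
end

section
/- Let k ≥ 1 be an integer and let D be a finite oriented graph whose underlying undirected graph has treewidth at most k (i.e., is a subgraph of a k-tree). Then the minimum size f(D) of a (directed) feedback vertex set of D satisfies f(D) ≤ (k/(k+3))·n(D). -/
/-- A graph is a `k`-tree iff it admits a chordal elimination ordering in which the
earlier neighbors of every vertex `v` form a clique of size exactly `min k (φ v)`
(`φ` is 0-indexed). -/
def IsKTree {V : Type*} [Fintype V] (G : SimpleGraph V) (k : ℕ) : Prop :=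
  ∃ φ : V ≃ Fin (Fintype.card V),
    ∀ v : V, G.IsClique {u | G.Adj v u ∧ (φ u : ℕ) < (φ v : ℕ)} ∧
      ({u | G.Adj v u ∧ (φ u : ℕ) < (φ v : ℕ)}).ncard = min k (φ v : ℕ)

/-- A graph has treewidth at most `k` iff it is a subgraph of a `k`-tree. -/
def TreewidthLE {V : Type*} [Fintype V] (G : SimpleGraph V) (k : ℕ) : Prop :=
  ∃ H : SimpleGraph V, IsKTree H k ∧ G ≤ H

/-- `F` is a feedback vertex set of the digraph given by the arc relation `A`. -/
def DirFVS {V : Type*} (A : V → V → Prop) (F : Set V) : Prop :=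
  ∀ v : V, ¬ Relation.TransGen (fun x y => x ∉ F ∧ y ∉ F ∧ A x y) v v

/-- `dirFvsNum A` is the minimum size of a directed feedback vertex set. -/
noncomputable def dirFvsNum {V : Type*} [Fintype V] (A : V → V → Prop) : ℕ :=
  sInf {n | ∃ F : Set V, DirFVS A F ∧ F.ncard = n}


namespace FVSProof

open Relation

/-- `Y` induces an acyclic digraph, witnessed by a rank function. -/
def Acy {V : Type*} (A : V → V → Prop) (Y : Finset V) : Prop :=
  ∃ f : V → ℤ, ∀ x ∈ Y, ∀ y ∈ Y, A x y → f x < f y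

section glue
variable {V : Type*} [DecidableEq V] {A : V → V → Prop}

lemma Acy.mono {P Q : Finset V} (h : Acy A Q) (hPQ : P ⊆ Q) : Acy A P := by
  obtain ⟨f, hf⟩ := h
  exact ⟨f, fun x hx y hy => hf x (hPQ hx) y (hPQ hy)⟩

lemma glueV {P Q : Finset V} {z : V} (hP : Acy A P) (hQ : Acy A (insert z Q)) (hz : z ∉ Q)
    (hd : Disjoint P Q)
    (h : ∀ x ∈ P, ∀ y ∈ Q, (A x y ∨ A y x) → x = z) : Acy A (P ∪ Q) := by
  classical
  obtain ⟨f, hf⟩ := hP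
  obtain ⟨g, hg⟩ := hQ
  have hd' : ∀ x ∈ P, x ∉ Q := fun x hx hx' => (Finset.disjoint_left.1 hd) hx hx'
  refine ⟨fun x => if x ∈ Q then g x - g z + f z else f x, ?_⟩
  intro x hx y hy hxy
  rw [Finset.mem_union] at hx hy
  by_cases hxQ : x ∈ Q
  · by_cases hyQ : y ∈ Q
    · have := hg x (by simp [hxQ]) y (by simp [hyQ]) hxy
      simp [hxQ, hyQ]; omega
    · have hyP : y ∈ P := by tauto
      have hyz := h y hyP x hxQ (Or.inr hxy)
      subst hyz
      have := hg x (by simp [hxQ]) y (by simp) hxy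
      simp [hxQ, hyQ]; omega
  · have hxP : x ∈ P := by tauto
    by_cases hyQ : y ∈ Q
    · have hyz := h x hxP y hyQ (Or.inl hxy)
      subst hyz
      have := hg x (by simp) y (by simp [hyQ]) hxy
      simp [hxQ, hyQ]; omega
    · have hyP : y ∈ P := by tauto
      have := hf x hxP y hyP hxy
      simp [hxQ, hyQ]; omega

lemma glueE (hA : ∀ u v, A u v → ¬ A v u) {P Q : Finset V} {p q : V} (hP : Acy A P)
    (hQ : Acy A Q) (hd : Disjoint P Q)
    (h : ∀ x ∈ P, ∀ y ∈ Q, (A x y ∨ A y x) → x = p ∧ y = q) : Acy A (P ∪ Q) := by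
  classical
  obtain ⟨f, hf⟩ := hP
  obtain ⟨g, hg⟩ := hQ
  have hd' : ∀ x ∈ P, x ∉ Q := fun x hx hx' => (Finset.disjoint_left.1 hd) hx hx'
  refine ⟨fun x => if x ∈ Q then g x - g q + f p + (if A p q then 1 else -1) else f x, ?_⟩
  intro x hx y hy hxy
  rw [Finset.mem_union] at hx hy
  by_cases hxQ : x ∈ Q
  · by_cases hyQ : y ∈ Q
    · have := hg x hxQ y hyQ hxy
      simp [hxQ, hyQ]; omega
    · have hyP : y ∈ P := by tauto
      obtain ⟨rfl, rfl⟩ := h y hyP x hxQ (Or.inr hxy)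
      have := hA _ _ hxy
      simp [hxQ, hyQ, this]
  · have hxP : x ∈ P := by tauto
    by_cases hyQ : y ∈ Q
    · obtain ⟨rfl, rfl⟩ := h x hxP y hyQ (Or.inl hxy)
      simp [hxQ, hyQ, hxy]
    · have hyP : y ∈ P := by tauto
      have := hf x hxP y hyP hxy
      simp [hxQ, hyQ]; omega

lemma glue0 (hA : ∀ u v, A u v → ¬ A v u) {P Q : Finset V} (hP : Acy A P)
    (hQ : Acy A Q) (hd : Disjoint P Q)
    (h : ∀ x ∈ P, ∀ y ∈ Q, ¬ (A x y ∨ A y x)) : Acy A (P ∪ Q) := by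
  rcases P.eq_empty_or_nonempty with rfl | ⟨p, hp⟩
  · simpa using hQ
  · exact glueE hA (p := p) (q := p) hP hQ hd (fun x hx y hy hh => absurd hh (h x hx y hy))

lemma acy_empty : Acy A (∅ : Finset V) := ⟨fun _ => 0, by simp⟩

lemma acy_single (hA : ∀ u v, A u v → ¬ A v u) (x : V) : Acy A ({x} : Finset V) := by
  refine ⟨fun _ => 0, ?_⟩
  intro a ha b hb hab
  simp at ha hb
  subst ha; subst hb
  exact absurd hab (hA _ _ hab)

lemma acy_pair (hA : ∀ u v, A u v → ¬ A v u) (x y : V) : Acy A ({x, y} : Finset V) := by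
  by_cases hxy : x = y
  · subst hxy; simpa using acy_single hA x
  · have := glueE hA (p := x) (q := y) (acy_single hA x) (acy_single hA y)
      (by simpa using hxy) (by simp)
    exact this

lemma acy_src (hA : ∀ u v, A u v → ¬ A v u) (z x y : V) (h1 : ¬ A x z) (h2 : ¬ A y z) :
    Acy A (insert z ({x, y} : Finset V)) := by
  classical
  obtain ⟨f, hf⟩ := acy_pair hA x y
  have hzz : ¬ A z z := fun h => hA _ _ h h
  refine ⟨fun a => if a = z then - |f x| - |f y| - 1 else f a, ?_⟩
  have e1 := neg_abs_le (f x)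
  have e2 := neg_abs_le (f y)
  have e3 := abs_nonneg (f x)
  have e4 := abs_nonneg (f y)
  intro a ha b hb hab
  by_cases hbz : b = z
  · subst hbz
    simp only [Finset.mem_insert, Finset.mem_singleton] at ha
    rcases ha with rfl | rfl | rfl <;> contradiction
  · have hb' : b ∈ ({x, y} : Finset V) := by simpa [hbz] using hb
    by_cases haz : a = z
    · subst haz
      simp only [Finset.mem_insert, Finset.mem_singleton] at hb'
      rcases hb' with rfl | rfl <;> simp [hbz] <;> omega
    · have ha' : a ∈ ({x, y} : Finset V) := by simpa [haz] using ha
      simpa [haz, hbz] using hf a ha' b hb' hab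

lemma acy_snk (hA : ∀ u v, A u v → ¬ A v u) (z x y : V) (h1 : ¬ A z x) (h2 : ¬ A z y) :
    Acy A (insert z ({x, y} : Finset V)) := by
  have := acy_src (A := fun a b => A b a) (fun u v h => hA v u h) z x y h1 h2
  obtain ⟨f, hf⟩ := this
  refine ⟨fun a => - f a, fun a ha b hb hab => ?_⟩
  have := hf b hb a ha hab
  simp only; omega

/-- Keeping part of a small set together with a given vertex. -/
lemma keep3 (hA : ∀ u v, A u v → ¬ A v u) (z : V) (C : Finset V) (hC : C.card = 3) :
    ∃ C' ⊆ C, C'.card = 2 ∧ Acy A (insert z C') := by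
  obtain ⟨a, b, c, hab, hac, hbc, rfl⟩ := Finset.card_eq_three.1 hC
  have key : ∀ p q : V, p ≠ q → p ∈ ({a, b, c} : Finset V) → q ∈ ({a, b, c} : Finset V) →
      ((A z p ∧ A z q) ∨ (¬ A z p ∧ ¬ A z q)) →
      ∃ C' ⊆ ({a, b, c} : Finset V), C'.card = 2 ∧ Acy A (insert z C') := by
    intro p q hpq hp hq h
    refine ⟨{p, q}, ?_, Finset.card_pair hpq, ?_⟩
    · intro x hx
      simp only [Finset.mem_insert, Finset.mem_singleton] at hx
      rcases hx with rfl | rfl <;> assumption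
    · rcases h with ⟨h1, h2⟩ | ⟨h1, h2⟩
      · exact acy_src hA z p q (hA _ _ h1) (hA _ _ h2)
      · exact acy_snk hA z p q h1 h2
  by_cases h1 : A z a <;> by_cases h2 : A z b <;> by_cases h3 : A z c
  all_goals first
    | exact key a b hab (by simp) (by simp) (by tauto)
    | exact key a c hac (by simp) (by simp) (by tauto)
    | exact key b c hbc (by simp) (by simp) (by tauto)

lemma keep1 (hA : ∀ u v, A u v → ¬ A v u) (z : V) (C : Finset V) (hC : 1 ≤ C.card) :
    ∃ C' ⊆ C, C'.card = 1 ∧ Acy A (insert z C') := by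
  obtain ⟨x, hx⟩ := Finset.card_pos.1 hC
  exact ⟨{x}, by simpa using hx, by simp, acy_pair hA z x⟩

lemma keep4 (hA : ∀ u v, A u v → ¬ A v u) (C : Finset V) (hC : C.card = 4) :
    ∃ C' ⊆ C, C'.card = 3 ∧ Acy A C' := by
  obtain ⟨z, hz⟩ : C.Nonempty := Finset.card_pos.1 (by omega)
  obtain ⟨C', h1, h2, h3⟩ := keep3 hA z (C.erase z) (by rw [Finset.card_erase_of_mem hz, hC])
  refine ⟨insert z C', ?_, ?_, h3⟩
  · intro x hx
    rcases Finset.mem_insert.1 hx with rfl | hx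
    · exact hz
    · exact Finset.mem_of_mem_erase (h1 hx)
  · rw [Finset.card_insert_of_notMem (fun h => by simpa using h1 h), h2]

lemma keepv (hA : ∀ u v, A u v → ¬ A v u) (z : V) (C : Finset V) (h1 : 1 ≤ C.card)
    (h3 : C.card ≤ 3) :
    ∃ C' ⊆ C, C'.card = (if C.card = 3 then 2 else 1) ∧ Acy A (insert z C') := by
  split_ifs with h
  · exact keep3 hA z C h
  · exact keep1 hA z C h1

lemma dropv (hA : ∀ u v, A u v → ¬ A v u) (C : Finset V) (h1 : 1 ≤ C.card)
    (h3 : C.card ≤ 3) :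
    ∃ C' ⊆ C, C'.card = (if C.card = 1 then 1 else 2) ∧ Acy A C' := by
  split_ifs with h
  · obtain ⟨x, rfl⟩ := Finset.card_eq_one.1 h
    exact ⟨_, subset_rfl, h, acy_single hA x⟩
  · obtain ⟨C', hs, hc⟩ := Finset.exists_subset_card_eq (show 2 ≤ C.card by omega)
    refine ⟨C', hs, hc, ?_⟩
    obtain ⟨x, y, -, rfl⟩ := Finset.card_eq_two.1 hc
    exact acy_pair hA x y

end glue

section tree
variable {V : Type*} [DecidableEq V] (H : SimpleGraph V) (φ : V → ℕ) (S : Finset V)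

open Classical in
/-- Earlier neighbours of `v` inside `S`. -/
noncomputable def Bk (v : V) : Finset V := S.filter (fun u => H.Adj v u ∧ φ u < φ v)

/-- `v` is the parent of `w`: the latest of its earlier neighbours. -/
def Par (w v : V) : Prop := w ∈ S ∧ v ∈ Bk H φ S w ∧ ∀ u ∈ Bk H φ S w, φ u ≤ φ v

open Classical in
/-- The descendants of `v`. -/
noncomputable def Tr (v : V) : Finset V := S.filter (fun x => ReflTransGen (Par H φ S) x v)

open Classical in
/-- The children of `v`. -/
noncomputable def Ch (v : V) : Finset V := S.filter (fun x => Par H φ S x v)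

variable {H φ S}

lemma mem_Bk {v u : V} : u ∈ Bk H φ S v ↔ u ∈ S ∧ H.Adj v u ∧ φ u < φ v := by
  classical
  simp [Bk]


lemma mem_Tr {v x : V} : x ∈ Tr H φ S v ↔ x ∈ S ∧ ReflTransGen (Par H φ S) x v := by
  classical
  simp [Tr]

lemma mem_Ch {v x : V} : x ∈ Ch H φ S v ↔ Par H φ S x v := by
  classical
  simp only [Ch, Finset.mem_filter, and_iff_right_iff_imp]
  exact fun h => h.1

lemma Par.lt {w v : V} (h : Par H φ S w v) : φ v < φ w := (mem_Bk.1 h.2.1).2.2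

lemma Par.memS {w v : V} (h : Par H φ S w v) : v ∈ S := (mem_Bk.1 h.2.1).1

lemma rtg_le {x v : V} (h : ReflTransGen (Par H φ S) x v) : φ v ≤ φ x := by
  induction h with
  | refl => exact le_rfl
  | tail _ h2 ih => exact h2.lt.le.trans ih

lemma self_mem_Tr {v : V} (hv : v ∈ S) : v ∈ Tr H φ S v := mem_Tr.2 ⟨hv, .refl⟩

/-- the earlier-neighbourhoods in `H` are cliques -/
def Chord (H : SimpleGraph V) (φ : V → ℕ) : Prop :=
  ∀ v a b, H.Adj v a → H.Adj v b → φ a < φ v → φ b < φ v → a ≠ b → H.Adj a b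

lemma Bk_par (hφ : Function.Injective φ) (hc : Chord H φ) {w v u : V} (h : Par H φ S w v)
    (hu : u ∈ Bk H φ S w) : u = v ∨ u ∈ Bk H φ S v := by
  by_cases huv : u = v
  · exact Or.inl huv
  · right
    have h1 := mem_Bk.1 hu
    have h2 := mem_Bk.1 h.2.1
    have h3 := h.2.2 u hu
    have h4 : φ u ≠ φ v := fun e => huv (hφ e)
    exact mem_Bk.2 ⟨h1.1, hc w v u h2.2.1 h1.2.1 h2.2.2 h1.2.2 (Ne.symm huv), by omega⟩

lemma exists_par {w u : V} (hw : w ∈ S) (hu : u ∈ Bk H φ S w) : ∃ v, Par H φ S w v := by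
  obtain ⟨v, hv, hm⟩ := Finset.exists_max_image (Bk H φ S w) φ ⟨u, hu⟩
  exact ⟨v, hw, hv, hm⟩

lemma Bk_rtg (hφ : Function.Injective φ) (hc : Chord H φ) {x v : V}
    (h : ReflTransGen (Par H φ S) x v) : ∀ u ∈ Bk H φ S x, u ∈ Tr H φ S v ∨ u ∈ Bk H φ S v := by
  induction h using ReflTransGen.head_induction_on with
  | refl => exact fun u hu => Or.inr hu
  | head h1 h2 ih =>
    intro u hu
    rcases Bk_par hφ hc h1 hu with rfl | h
    · exact Or.inl (mem_Tr.2 ⟨h1.memS, h2⟩)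
    · exact ih u h

lemma rtg_of_Bk (hφ : Function.Injective φ) (hc : Chord H φ) (x : V) :
    ∀ n y, φ y = n → y ∈ S → x ∈ Bk H φ S y → ReflTransGen (Par H φ S) y x := by
  intro n
  induction n using Nat.strong_induction_on with
  | _ n ih =>
    intro y hn hy hx
    obtain ⟨p, hp⟩ := exists_par hy hx
    rcases Bk_par hφ hc hp hx with rfl | h
    · exact .single hp
    · exact .head hp (ih (φ p) (hn ▸ hp.lt) p rfl hp.memS h)

/-- The neighbourhood of a subtree. -/
lemma Tr_nbr (hφ : Function.Injective φ) (hc : Chord H φ) {x y v : V} (hx : x ∈ Tr H φ S v)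
    (hy : y ∈ S) (hxy : H.Adj x y) : y ∈ Tr H φ S v ∨ y ∈ Bk H φ S v := by
  have hx' := mem_Tr.1 hx
  rcases lt_trichotomy (φ x) (φ y) with h | h | h
  · left
    have : ReflTransGen (Par H φ S) y x :=
      rtg_of_Bk hφ hc x _ y rfl hy (mem_Bk.2 ⟨hx'.1, hxy.symm, h⟩)
    exact mem_Tr.2 ⟨hy, this.trans hx'.2⟩
  · exact absurd (hφ h) hxy.ne
  · exact Bk_rtg hφ hc hx'.2 y (mem_Bk.2 ⟨hy, hxy, h⟩)

lemma Par_unique (hφ : Function.Injective φ) {w v v' : V} (h : Par H φ S w v)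
    (h' : Par H φ S w v') : v = v' :=
  hφ (le_antisymm (h'.2.2 v h.2.1) (h.2.2 v' h'.2.1))

lemma Tr_disj (hφ : Function.Injective φ) {v w w' : V} (hw : Par H φ S w v)
    (hw' : Par H φ S w' v) (hne : w ≠ w') : Disjoint (Tr H φ S w) (Tr H φ S w') := by
  have aux : ∀ a b : V, Par H φ S a v → Par H φ S b v → a ≠ b →
      ¬ ReflTransGen (Par H φ S) a b := by
    intro a b ha hb hab h
    rcases ReflTransGen.cases_head h with h | ⟨c, hac, hcb⟩
    · exact hab h
    · have := Par_unique hφ hac ha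
      subst this
      have h1 := rtg_le hcb
      have h2 := hb.lt
      omega
  rw [Finset.disjoint_left]
  intro x hx hx'
  have hU : Relator.RightUnique (Par H φ S) := fun a b c h1 h2 => Par_unique hφ h1 h2
  rcases ReflTransGen.total_of_right_unique hU (mem_Tr.1 hx).2 (mem_Tr.1 hx').2 with h | h
  · exact aux w w' hw hw' hne h
  · exact aux w' w hw' hw hne.symm h

lemma v_notMem_Tr {v w : V} (hw : Par H φ S w v) : v ∉ Tr H φ S w := by
  intro h
  have h1 := rtg_le (mem_Tr.1 h).2
  have h2 := hw.lt
  omega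

lemma Bk_notMem_Tr {v u : V} (hu : u ∈ Bk H φ S v) : u ∉ Tr H φ S v := by
  intro h
  have h1 := rtg_le (mem_Tr.1 h).2
  have h2 := (mem_Bk.1 hu).2.2
  omega

lemma Tr_nonadj (hφ : Function.Injective φ) (hc : Chord H φ) {v w w' : V} (hw : Par H φ S w v)
    (hw' : Par H φ S w' v) (hne : w ≠ w') {x y : V} (hx : x ∈ Tr H φ S w)
    (hy : y ∈ Tr H φ S w') : ¬ H.Adj x y := by
  intro hxy
  have hyS := (mem_Tr.1 hy).1
  rcases Tr_nbr hφ hc hx hyS hxy with h | h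
  · exact Finset.disjoint_left.1 (Tr_disj hφ hw hw' hne) h hy
  · have h1 := rtg_le (mem_Tr.1 hy).2
    have h3 := hw'.lt
    have h4 : φ y ≤ φ v := hw.2.2 y h
    omega

lemma Tr_child_sub {v w : V} (hw : Par H φ S w v) : Tr H φ S w ⊆ Tr H φ S v := by
  intro x hx
  exact mem_Tr.2 ⟨(mem_Tr.1 hx).1, (mem_Tr.1 hx).2.tail hw⟩

lemma Tr_eq {v : V} (hv : v ∈ S) :
    Tr H φ S v = insert v ((Ch H φ S v).biUnion (Tr H φ S)) := by
  ext x
  simp only [Finset.mem_insert, Finset.mem_biUnion, mem_Ch]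
  constructor
  · intro h
    obtain ⟨hx, h⟩ := mem_Tr.1 h
    rcases ReflTransGen.cases_tail h with h | ⟨c, h1, h2⟩
    · exact Or.inl h.symm
    · exact Or.inr ⟨c, h2, mem_Tr.2 ⟨hx, h1⟩⟩
  · rintro (rfl | ⟨w, hw, hx⟩)
    · exact self_mem_Tr hv
    · exact Tr_child_sub hw hx

lemma card_Tr (hφ : Function.Injective φ) {v : V} (hv : v ∈ S) :
    (Tr H φ S v).card = 1 + ∑ w ∈ Ch H φ S v, (Tr H φ S w).card := by
  rw [Tr_eq hv, Finset.card_insert_of_notMem, Finset.card_biUnion, add_comm]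
  · intro a ha b hb hab
    exact Tr_disj hφ (mem_Ch.1 ha) (mem_Ch.1 hb) hab
  · simp only [Finset.mem_biUnion, not_exists, not_and]
    intro w hw
    exact v_notMem_Tr (mem_Ch.1 hw)

end tree

section red
variable {V : Type*} [DecidableEq V] {H : SimpleGraph V} {φ : V → ℕ} {S : Finset V}
  {A : V → V → Prop}

lemma sums (t : V → ℕ) (s : Finset V) (ht : ∀ w ∈ s, 1 ≤ t w ∧ t w ≤ 3) :
    ∃ p q r : ℕ, s.card = p + q + r ∧ ∑ w ∈ s, t w = p + 2 * q + 3 * r ∧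
      ∑ w ∈ s, (if t w = 3 then 2 else 1) = p + q + 2 * r ∧
      ∑ w ∈ s, (if t w = 1 then 1 else 2) = p + 2 * q + 2 * r := by
  induction s using Finset.induction_on with
  | empty => exact ⟨0, 0, 0, by simp⟩
  | insert a s ha ih =>
    obtain ⟨p, q, r, h1, h2, h3, h4⟩ := ih (fun w hw => ht w (by simp [hw]))
    have hta := ht a (by simp)
    simp only [Finset.card_insert_of_notMem ha, Finset.sum_insert ha]
    obtain h | h | h : t a = 1 ∨ t a = 2 ∨ t a = 3 := by omega
    · exact ⟨p + 1, q, r, by omega, by omega, by simp [h]; omega, by simp [h]; omega⟩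
    · exact ⟨p, q + 1, r, by omega, by omega, by simp [h]; omega, by simp [h]; omega⟩
    · exact ⟨p, q, r + 1, by omega, by omega, by simp [h]; omega, by simp [h]; omega⟩

lemma keepUnion (hH : ∀ x y, A x y ∨ A y x → H.Adj x y) (hA : ∀ u v, A u v → ¬ A v u)
    (hφ : Function.Injective φ) (hc : Chord H φ) (v : V)
    (C : V → Finset V) (hC : ∀ w ∈ Ch H φ S v, C w ⊆ Tr H φ S w)
    (hC' : ∀ w ∈ Ch H φ S v, Acy A (insert v (C w))) (s : Finset V) :
    s ⊆ Ch H φ S v → Acy A (insert v (s.biUnion C)) := by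
  induction s using Finset.induction_on with
  | empty => intro _; simpa using acy_single hA v
  | insert a s ha ih =>
    intro hs
    have hs' : s ⊆ Ch H φ S v := fun x hx => hs (by simp [hx])
    have haC : a ∈ Ch H φ S v := hs (by simp)
    have hva : v ∉ C a := fun h => v_notMem_Tr (mem_Ch.1 haC) (hC a haC h)
    have e : insert v ((insert a s).biUnion C) = insert v (s.biUnion C) ∪ C a := by
      rw [Finset.biUnion_insert, Finset.insert_union, Finset.union_comm]
    rw [e]
    have hne : ∀ w ∈ s, w ≠ a := by rintro w hw rfl; exact ha hw
    refine glueV (z := v) (ih hs') (hC' a haC) hva ?_ ?_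
    · rw [Finset.disjoint_left]
      intro x hx hxa
      rcases Finset.mem_insert.1 hx with rfl | hx
      · exact hva hxa
      · obtain ⟨w, hw, hxw⟩ := Finset.mem_biUnion.1 hx
        exact Finset.disjoint_left.1
          (Tr_disj hφ (mem_Ch.1 (hs' hw)) (mem_Ch.1 haC) (hne w hw))
          (hC w (hs' hw) hxw) (hC a haC hxa)
    · intro x hx y hy hxy
      rcases Finset.mem_insert.1 hx with rfl | hx
      · rfl
      · obtain ⟨w, hw, hxw⟩ := Finset.mem_biUnion.1 hx
        exact absurd (hH _ _ hxy) (Tr_nonadj hφ hc (mem_Ch.1 (hs' hw)) (mem_Ch.1 haC) (hne w hw)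
          (hC w (hs' hw) hxw) (hC a haC hy))

lemma dropUnion (hH : ∀ x y, A x y ∨ A y x → H.Adj x y) (hA : ∀ u v, A u v → ¬ A v u)
    (hφ : Function.Injective φ) (hc : Chord H φ) (v : V)
    (C : V → Finset V) (hC : ∀ w ∈ Ch H φ S v, C w ⊆ Tr H φ S w)
    (hC' : ∀ w ∈ Ch H φ S v, Acy A (C w)) (s : Finset V) :
    s ⊆ Ch H φ S v → Acy A (s.biUnion C) := by
  induction s using Finset.induction_on with
  | empty => intro _; simpa using acy_empty
  | insert a s ha ih =>
    intro hs
    have hs' : s ⊆ Ch H φ S v := fun x hx => hs (by simp [hx])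
    have haC : a ∈ Ch H φ S v := hs (by simp)
    rw [Finset.biUnion_insert, Finset.union_comm]
    have hne : ∀ w ∈ s, w ≠ a := by rintro w hw rfl; exact ha hw
    refine glue0 hA (ih hs') (hC' a haC) ?_ ?_
    · rw [Finset.disjoint_left]
      intro x hx hxa
      obtain ⟨w, hw, hxw⟩ := Finset.mem_biUnion.1 hx
      exact Finset.disjoint_left.1
          (Tr_disj hφ (mem_Ch.1 (hs' hw)) (mem_Ch.1 haC) (hne w hw))
          (hC w (hs' hw) hxw) (hC a haC hxa)
    · intro x hx y hy hxy
      obtain ⟨w, hw, hxw⟩ := Finset.mem_biUnion.1 hx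
      exact absurd (hH _ _ hxy) (Tr_nonadj hφ hc (mem_Ch.1 (hs' hw)) (mem_Ch.1 haC) (hne w hw)
          (hC w (hs' hw) hxw) (hC a haC hy))

lemma card_bU (hφ : Function.Injective φ) (v : V)
    (C : V → Finset V) (hC : ∀ w ∈ Ch H φ S v, C w ⊆ Tr H φ S w) :
    ((Ch H φ S v).biUnion C).card = ∑ w ∈ Ch H φ S v, (C w).card := by
  apply Finset.card_biUnion
  intro a ha b hb hab
  exact Finset.disjoint_of_subset_left (hC a ha) (Finset.disjoint_of_subset_right (hC b hb)
    (Tr_disj hφ (mem_Ch.1 ha) (mem_Ch.1 hb) hab))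

/-- A reducible configuration in `S`. -/
def Red (A : V → V → Prop) (k : ℕ) (S : Finset V) : Prop :=
  ∃ R K : Finset V, R ⊆ S ∧ K ⊆ R ∧ R.Nonempty ∧ 3 * R.card ≤ (k + 3) * K.card ∧
    ∀ Y ⊆ S \ R, Acy A Y → Acy A (Y ∪ K)

/-- Cutting off a whole subtree by removing its attachment. -/
lemma red_full (hH : ∀ x y, A x y ∨ A y x → H.Adj x y) (hA : ∀ u v, A u v → ¬ A v u)
    (hφ : Function.Injective φ) (hc : Chord H φ) {k : ℕ} {v : V} (hv : v ∈ S)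
    {K : Finset V} (hK : K ⊆ Tr H φ S v) (hKa : Acy A K)
    (hcard : 3 * ((Tr H φ S v).card + (Bk H φ S v).card) ≤ (k + 3) * K.card) : Red A k S := by
  refine ⟨Tr H φ S v ∪ Bk H φ S v, K, ?_, ?_, ⟨v, ?_⟩, ?_, ?_⟩
  · intro x hx
    rcases Finset.mem_union.1 hx with h | h
    · exact (mem_Tr.1 h).1
    · exact (mem_Bk.1 h).1
  · exact hK.trans Finset.subset_union_left
  · exact Finset.mem_union_left _ (self_mem_Tr hv)
  · have := Finset.card_union_le (Tr H φ S v) (Bk H φ S v)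
    omega
  · intro Y hY hYa
    have hY' : ∀ y ∈ Y, y ∈ S ∧ y ∉ Tr H φ S v ∧ y ∉ Bk H φ S v := by
      intro y hy
      simpa using hY hy
    refine glue0 hA hYa hKa ?_ ?_
    · rw [Finset.disjoint_left]
      exact fun y hy hyK => (hY' y hy).2.1 (hK hyK)
    · intro y hy x hx hxy
      have := Tr_nbr hφ hc (hK hx) (hY' y hy).1 (hH _ _ hxy).symm
      have := hY' y hy
      tauto

lemma exists_u {k : ℕ} (hφ : Function.Injective φ) (hc : Chord H φ)
    (hk : ∀ v, (Bk H φ S v).card ≤ k) {v w : V} (hw : Par H φ S w v) :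
    ∃ u, ((Bk H φ S v).erase u).card + 1 ≤ k ∧ (u ∈ Bk H φ S v → u ∉ Bk H φ S w) ∧
      u ∉ (Ch H φ S v).biUnion (Tr H φ S) := by
  have hvn : v ∉ Bk H φ S v := fun h => by
    have := (mem_Bk.1 h).2.2
    omega
  by_cases h : Bk H φ S v ⊆ Bk H φ S w
  · refine ⟨v, ?_, fun h => absurd h hvn, ?_⟩
    · have h1 : insert v (Bk H φ S v) ⊆ Bk H φ S w := by
        intro x hx
        rcases Finset.mem_insert.1 hx with rfl | hx
        · exact hw.2.1
        · exact h hx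
      have h2 := Finset.card_le_card h1
      rw [Finset.card_insert_of_notMem hvn] at h2
      rw [Finset.erase_eq_of_notMem hvn]
      exact h2.trans (hk w)
    · simp only [Finset.mem_biUnion, not_exists, not_and]
      exact fun w hw => v_notMem_Tr (mem_Ch.1 hw)
  · rw [Finset.not_subset] at h
    obtain ⟨u, hu, huw⟩ := h
    refine ⟨u, ?_, fun _ => huw, ?_⟩
    · have := Finset.card_erase_add_one hu
      have := hk v
      omega
    · simp only [Finset.mem_biUnion, not_exists, not_and]
      exact fun w hw h => Bk_notMem_Tr hu (Tr_child_sub (mem_Ch.1 hw) h)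

lemma red_single (hH : ∀ x y, A x y ∨ A y x → H.Adj x y) (hA : ∀ u v, A u v → ¬ A v u)
    (hφ : Function.Injective φ) (hc : Chord H φ) {k : ℕ}
    (hk : ∀ v, (Bk H φ S v).card ≤ k) {v w : V} (hv : v ∈ S)
    (hw : Ch H φ S v = {w}) (h4 : (Tr H φ S v).card = 4) : Red A k S := by
  have hwp : Par H φ S w v := mem_Ch.1 (by simp [hw])
  obtain ⟨u, hu1, hu2, hu3⟩ := exists_u hφ hc hk hwp
  obtain ⟨K, hK, hK3, hKa⟩ := keep4 hA _ h4
  refine ⟨Tr H φ S v ∪ (Bk H φ S v).erase u, K, ?_, ?_, ⟨v, ?_⟩, ?_, ?_⟩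
  · intro x hx
    rcases Finset.mem_union.1 hx with h | h
    · exact (mem_Tr.1 h).1
    · exact (mem_Bk.1 (Finset.mem_of_mem_erase h)).1
  · exact hK.trans Finset.subset_union_left
  · exact Finset.mem_union_left _ (self_mem_Tr hv)
  · have := Finset.card_union_le (Tr H φ S v) ((Bk H φ S v).erase u)
    rw [hK3]
    omega
  · intro Y hY hYa
    have hY' : ∀ y ∈ Y, y ∈ S ∧ y ∉ Tr H φ S v ∧ (y ∈ Bk H φ S v → y = u) := by
      intro y hy
      have := hY hy
      simp only [Finset.mem_sdiff, Finset.mem_union, Finset.mem_erase] at this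
      tauto
    refine glueE hA (p := u) (q := v) hYa hKa ?_ ?_
    · rw [Finset.disjoint_left]
      exact fun y hy hyK => (hY' y hy).2.1 (hK hyK)
    · intro y hy x hx hxy
      have hadj := (hH _ _ hxy).symm
      obtain ⟨hyS, hyT, hyB⟩ := hY' y hy
      have h1 : y ∈ Bk H φ S v := (Tr_nbr hφ hc (hK hx) hyS hadj).resolve_left hyT
      have hyu := hyB h1
      refine ⟨hyu, ?_⟩
      have hxT := hK hx
      rw [Tr_eq hv, hw] at hxT
      simp only [Finset.mem_insert, Finset.singleton_biUnion] at hxT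
      rcases hxT with h | h
      · exact h
      · exfalso
        rcases Tr_nbr hφ hc h hyS hadj with h' | h'
        · exact hyT (Tr_child_sub hwp h')
        · subst hyu
          exact hu2 h1 h'

lemma red_double (hH : ∀ x y, A x y ∨ A y x → H.Adj x y) (hA : ∀ u v, A u v → ¬ A v u)
    (hφ : Function.Injective φ) (hc : Chord H φ) {k : ℕ} (hk3 : 3 ≤ k)
    (hk : ∀ v, (Bk H φ S v).card ≤ k) {v w c : V} (hv : v ∈ S) (hwc : w ≠ c)
    (hw : Ch H φ S v = {w, c}) (h2 : (Tr H φ S w).card = 2)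
    (h13 : (Tr H φ S c).card = 1 ∨ (Tr H φ S c).card = 3) : Red A k S := by
  have hwp : Par H φ S w v := mem_Ch.1 (by simp [hw])
  have hcp : Par H φ S c v := mem_Ch.1 (by simp [hw])
  obtain ⟨u, hu1, hu2, hu3⟩ := exists_u hφ hc hk hwp
  obtain ⟨C, hC, hCc, hCa⟩ := keepv hA u (Tr H φ S c) (by omega) (by omega)
  have hTv : (Tr H φ S v).card = 3 + (Tr H φ S c).card := by
    rw [card_Tr hφ hv, hw, Finset.sum_pair hwc, h2]; omega
  have huC : u ∉ C := fun h => hu3 (Finset.mem_biUnion.2 ⟨c, mem_Ch.2 hcp, hC h⟩)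
  have hdis := Tr_disj hφ hwp hcp hwc
  have hTwa : Acy A (Tr H φ S w) := by
    obtain ⟨a, b, -, e⟩ := Finset.card_eq_two.1 h2
    rw [e]; exact acy_pair hA a b
  refine ⟨Tr H φ S v ∪ (Bk H φ S v).erase u, C ∪ Tr H φ S w, ?_, ?_, ⟨v, ?_⟩, ?_, ?_⟩
  · intro x hx
    rcases Finset.mem_union.1 hx with h | h
    · exact (mem_Tr.1 h).1
    · exact (mem_Bk.1 (Finset.mem_of_mem_erase h)).1
  · refine Finset.Subset.trans ?_ Finset.subset_union_left
    exact Finset.union_subset (hC.trans (Tr_child_sub hcp)) (Tr_child_sub hwp)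
  · exact Finset.mem_union_left _ (self_mem_Tr hv)
  · have := Finset.card_union_le (Tr H φ S v) ((Bk H φ S v).erase u)
    rw [Finset.card_union_of_disjoint
      (Finset.disjoint_of_subset_left hC hdis.symm), hCc, h2]
    rcases h13 with h | h <;> simp only [h] at hTv ⊢ <;> norm_num <;> omega
  · intro Y hY hYa
    have hY' : ∀ y ∈ Y, y ∈ S ∧ y ∉ Tr H φ S v ∧ (y ∈ Bk H φ S v → y = u) := by
      intro y hy
      have := hY hy
      simp only [Finset.mem_sdiff, Finset.mem_union, Finset.mem_erase] at this
      tauto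
    have g1 : Acy A (Y ∪ C) := by
      refine glueV (z := u) hYa hCa huC ?_ ?_
      · rw [Finset.disjoint_left]
        exact fun y hy hyK => (hY' y hy).2.1 (Tr_child_sub hcp (hC hyK))
      · intro y hy x hx hxy
        obtain ⟨hyS, hyT, hyB⟩ := hY' y hy
        exact hyB ((Tr_nbr hφ hc (Tr_child_sub hcp (hC hx)) hyS
          (hH _ _ hxy).symm).resolve_left hyT)
    rw [← Finset.union_assoc]
    refine glue0 hA g1 hTwa ?_ ?_
    · rw [Finset.disjoint_union_left]
      refine ⟨?_, Finset.disjoint_of_subset_left hC hdis.symm⟩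
      rw [Finset.disjoint_left]
      exact fun y hy hyK => (hY' y hy).2.1 (Tr_child_sub hwp hyK)
    · intro y hy x hx hxy
      have hadj := (hH _ _ hxy).symm
      rcases Finset.mem_union.1 hy with hy | hy
      · obtain ⟨hyS, hyT, hyB⟩ := hY' y hy
        have h1 : y ∈ Bk H φ S v := (Tr_nbr hφ hc (Tr_child_sub hwp hx) hyS hadj).resolve_left hyT
        have hyu := hyB h1
        rcases Tr_nbr hφ hc hx hyS hadj with h' | h'
        · exact hyT (Tr_child_sub hwp h')
        · subst hyu
          exact hu2 h1 h'
      · exact Tr_nonadj hφ hc hwp hcp hwc hx (hC hy) hadj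

lemma red_exists (hH : ∀ x y, A x y ∨ A y x → H.Adj x y) (hA : ∀ u v, A u v → ¬ A v u)
    (hφ : Function.Injective φ) (hc : Chord H φ) {k : ℕ} (hk3 : 3 ≤ k)
    (hk : ∀ v, (Bk H φ S v).card ≤ k) (hS : S.Nonempty) : Red A k S := by
  classical
  by_cases hbig : (S.filter (fun v => 4 ≤ (Tr H φ S v).card)).Nonempty
  · obtain ⟨v, hvf, hmax⟩ := Finset.exists_max_image _ φ hbig
    obtain ⟨hv, hv4⟩ := Finset.mem_filter.1 hvf
    have ht : ∀ w ∈ Ch H φ S v, 1 ≤ (Tr H φ S w).card ∧ (Tr H φ S w).card ≤ 3 := by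
      intro w hw
      have hwp := mem_Ch.1 hw
      refine ⟨Finset.card_pos.2 ⟨w, self_mem_Tr hwp.1⟩, ?_⟩
      by_contra hcon
      have := hmax w (Finset.mem_filter.2 ⟨hwp.1, by omega⟩)
      have := hwp.lt
      omega
    obtain ⟨p, q, r, hcd, hs1, hs2, hs3⟩ := sums (fun w => (Tr H φ S w).card) _ ht
    have hT := card_Tr (H := H) hφ hv
    rw [hs1] at hT
    have hBv := hk v
    by_cases c1 : 2 ≤ p + r
    · have : ∀ w, ∃ C : Finset V, w ∈ Ch H φ S v → C ⊆ Tr H φ S w ∧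
          C.card = (if (Tr H φ S w).card = 3 then 2 else 1) ∧ Acy A (insert v C) := by
        intro w
        by_cases hw : w ∈ Ch H φ S v
        · obtain ⟨C, h⟩ := keepv hA v (Tr H φ S w) (ht w hw).1 (ht w hw).2
          exact ⟨C, fun _ => h⟩
        · exact ⟨∅, fun h => absurd h hw⟩
      choose C hC using this
      have hsub : ∀ w ∈ Ch H φ S v, C w ⊆ Tr H φ S w := fun w hw => (hC w hw).1
      have hacy := keepUnion hH hA hφ hc v C hsub (fun w hw => (hC w hw).2.2) _ subset_rfl
      have hcard := card_bU hφ v C hsub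
      rw [Finset.sum_congr rfl (fun w hw => (hC w hw).2.1), hs2] at hcard
      have hvn : v ∉ (Ch H φ S v).biUnion C := by
        simp only [Finset.mem_biUnion, not_exists, not_and]
        exact fun w hw h => v_notMem_Tr (mem_Ch.1 hw) (hsub w hw h)
      refine red_full hH hA hφ hc hv (K := insert v ((Ch H φ S v).biUnion C)) ?_ hacy ?_
      · rw [Tr_eq hv]
        exact Finset.insert_subset_insert _ (Finset.biUnion_mono hsub)
      · rw [Finset.card_insert_of_notMem hvn, hcard, hT]
        obtain ⟨d, hd⟩ := Nat.exists_eq_add_of_le c1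
        obtain ⟨j, rfl⟩ := Nat.exists_eq_add_of_le hk3
        have e : p + q + 2 * r + 1 = 3 + (d + q + r) := by omega
        rw [e]
        have : 3 * (1 + (p + 2 * q + 3 * r) + (3 + j)) ≤ (3 + j + 3) * (3 + (d + q + r)) := by
          nlinarith [Nat.zero_le (j * (d + q + r))]
        omega
    by_cases c2 : 4 ≤ p + 2 * q + r
    · have : ∀ w, ∃ C : Finset V, w ∈ Ch H φ S v → C ⊆ Tr H φ S w ∧
          C.card = (if (Tr H φ S w).card = 1 then 1 else 2) ∧ Acy A C := by
        intro w
        by_cases hw : w ∈ Ch H φ S v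
        · obtain ⟨C, h⟩ := dropv hA (Tr H φ S w) (ht w hw).1 (ht w hw).2
          exact ⟨C, fun _ => h⟩
        · exact ⟨∅, fun h => absurd h hw⟩
      choose C hC using this
      have hsub : ∀ w ∈ Ch H φ S v, C w ⊆ Tr H φ S w := fun w hw => (hC w hw).1
      have hacy := dropUnion hH hA hφ hc v C hsub (fun w hw => (hC w hw).2.2) _ subset_rfl
      have hcard := card_bU hφ v C hsub
      rw [Finset.sum_congr rfl (fun w hw => (hC w hw).2.1), hs3] at hcard
      refine red_full hH hA hφ hc hv (K := ((Ch H φ S v).biUnion C)) ?_ hacy ?_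
      · rw [Tr_eq hv]
        exact (Finset.biUnion_mono hsub).trans (Finset.subset_insert _ _)
      · rw [hcard, hT]
        obtain ⟨d, hd⟩ := Nat.exists_eq_add_of_le c2
        obtain ⟨j, rfl⟩ := Nat.exists_eq_add_of_le hk3
        have e : p + 2 * q + 2 * r = 4 + d + r := by omega
        rw [e]
        have : 3 * (1 + (p + 2 * q + 3 * r) + (3 + j)) ≤ (3 + j + 3) * (4 + d + r) := by
          nlinarith [Nat.zero_le (j * (d + r))]
        omega
    by_cases c3 : q = 0
    · obtain ⟨w, hw⟩ := Finset.card_eq_one.1 (show (Ch H φ S v).card = 1 by omega)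
      exact red_single hH hA hφ hc hk hv hw (by omega)
    · obtain ⟨a, b, hab, hw⟩ := Finset.card_eq_two.1 (show (Ch H φ S v).card = 2 by omega)
      have ha := ht a (by simp [hw])
      have hb := ht b (by simp [hw])
      have hsum := hs1
      rw [hw, Finset.sum_pair hab] at hsum
      by_cases h2 : (Tr H φ S a).card = 2
      · exact red_double hH hA hφ hc hk3 hk hv hab hw h2 (by omega)
      · exact red_double hH hA hφ hc hk3 hk hv hab.symm (by rw [hw, Finset.pair_comm])
          (by omega) (by omega)
  · obtain ⟨v, hv, hmin⟩ := Finset.exists_min_image S φ hS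
    have hB : Bk H φ S v = ∅ := by
      rw [Finset.eq_empty_iff_forall_notMem]
      intro u hu
      have h1 := mem_Bk.1 hu
      have := hmin u h1.1
      omega
    have h3 : (Tr H φ S v).card ≤ 3 := by
      by_contra hcon
      exact hbig ⟨v, Finset.mem_filter.2 ⟨hv, by omega⟩⟩
    have h1 : 1 ≤ (Tr H φ S v).card := Finset.card_pos.2 ⟨v, self_mem_Tr hv⟩
    obtain ⟨K, hK, hKc, hKa⟩ := dropv hA _ h1 h3
    refine red_full hH hA hφ hc hv hK hKa ?_
    rw [hB, hKc, Finset.card_empty]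
    split_ifs <;> omega

lemma big_k (hH : ∀ x y, A x y ∨ A y x → H.Adj x y) (hA : ∀ u v, A u v → ¬ A v u)
    (hφ : Function.Injective φ) (hc : Chord H φ) {k : ℕ} (hk3 : 3 ≤ k)
    (hk : ∀ S v, (Bk H φ S v).card ≤ k) :
    ∀ n, ∀ S : Finset V, S.card = n →
      ∃ Y ⊆ S, Acy A Y ∧ 3 * S.card ≤ (k + 3) * Y.card := by
  intro n
  induction n using Nat.strong_induction_on with
  | _ n ih =>
    intro S hn
    rcases S.eq_empty_or_nonempty with rfl | hS
    · exact ⟨∅, by simp, acy_empty, by simp⟩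
    · obtain ⟨R, K, hR, hK, hne, hcard, hglue⟩ := red_exists hH hA hφ hc hk3 (hk S) hS
      have hRc := Finset.card_pos.2 hne
      have hsd := Finset.card_sdiff_add_card_eq_card hR
      obtain ⟨Y, hY, hYa, hYc⟩ := ih (S \ R).card (by omega) (S \ R) rfl
      refine ⟨Y ∪ K, ?_, hglue Y hY hYa, ?_⟩
      · exact Finset.union_subset (hY.trans Finset.sdiff_subset) (hK.trans hR)
      · have hd : Disjoint Y K := Finset.disjoint_of_subset_left hY
          (Finset.disjoint_of_subset_right hK Finset.sdiff_disjoint)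
        rw [Finset.card_union_of_disjoint hd, mul_add]
        omega

/-- If every vertex has at most one earlier neighbour then the set is acyclic. -/
lemma forest (hH : ∀ x y, A x y ∨ A y x → H.Adj x y) (hA : ∀ u v, A u v → ¬ A v u)
    (hφ : Function.Injective φ) (Y : Finset V)
    (h1 : ∀ v ∈ Y, ∀ a ∈ Bk H φ Y v, ∀ b ∈ Bk H φ Y v, a = b) : Acy A Y := by
  classical
  have key : ∀ n, Acy A (Y.filter (fun x => φ x < n)) := by
    intro n
    induction n with
    | zero => simpa using acy_empty
    | succ n ih =>
      by_cases hv : ∃ v ∈ Y, φ v = n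
      · obtain ⟨v, hvY, hvn⟩ := hv
        have e : Y.filter (fun x => φ x < n + 1) = Y.filter (fun x => φ x < n) ∪ {v} := by
          ext x
          simp only [Finset.mem_filter, Finset.mem_union, Finset.mem_singleton]
          constructor
          · rintro ⟨h2, h3⟩
            by_cases hx : φ x = n
            · exact Or.inr (hφ (hx.trans hvn.symm))
            · exact Or.inl ⟨h2, by omega⟩
          · rintro (⟨h2, h3⟩ | rfl)
            · exact ⟨h2, by omega⟩
            · exact ⟨hvY, by omega⟩
        rw [e]
        have hd : Disjoint (Y.filter (fun x => φ x < n)) {v} := by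
          simp [hvn]
        have hmem : ∀ x ∈ Y.filter (fun x => φ x < n), ∀ y ∈ ({v} : Finset V),
            (A x y ∨ A y x) → x ∈ Bk H φ Y v ∧ y = v := by
          intro x hx y hy hxy
          rw [Finset.mem_singleton] at hy
          subst hy
          rw [Finset.mem_filter] at hx
          exact ⟨mem_Bk.2 ⟨hx.1, (hH _ _ hxy).symm, by omega⟩, rfl⟩
        rcases (Bk H φ Y v).eq_empty_or_nonempty with h0 | ⟨p, hp⟩
        · refine glue0 hA ih (acy_single hA v) hd ?_
          intro x hx y hy hxy
          have := (hmem x hx y hy hxy).1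
          simp [h0] at this
        · refine glueE hA (p := p) (q := v) ih (acy_single hA v) hd ?_
          intro x hx y hy hxy
          exact ⟨h1 v hvY _ (hmem x hx y hy hxy).1 _ hp, (hmem x hx y hy hxy).2⟩
      · refine ih.mono ?_
        intro x hx
        rw [Finset.mem_filter] at hx ⊢
        refine ⟨hx.1, ?_⟩
        have : φ x ≠ n := fun h => hv ⟨x, hx.1, h⟩
        omega
  refine (key (Y.sup φ + 1)).mono ?_
  intro x hx
  exact Finset.mem_filter.2 ⟨hx, Nat.lt_succ_of_le (Finset.le_sup hx)⟩

lemma color3 (hφ : Function.Injective φ) (hk : ∀ v, (Bk H φ S v).card ≤ 2) :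
    ∀ n, ∃ c : V → Fin 3, ∀ v, φ v < n → ∀ u ∈ Bk H φ S v, c u ≠ c v := by
  intro n
  induction n with
  | zero => exact ⟨fun _ => 0, by simp⟩
  | succ n ih =>
    obtain ⟨c, hc⟩ := ih
    by_cases hv : ∃ v, φ v = n
    · obtain ⟨v, hvn⟩ := hv
      obtain ⟨i, hi⟩ : ∃ i : Fin 3, i ∉ (Bk H φ S v).image c := by
        by_contra hcon
        push Not at hcon
        have h1 : (Finset.univ : Finset (Fin 3)) ⊆ (Bk H φ S v).image c := fun i _ => hcon i
        have h2 := Finset.card_le_card h1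
        have h3 := Finset.card_image_le (s := Bk H φ S v) (f := c)
        have h4 := hk v
        simp at h2
        omega
      refine ⟨Function.update c v i, ?_⟩
      intro w hw u hu
      have hu' := mem_Bk.1 hu
      have huv : u ≠ v := by
        rintro rfl
        omega
      by_cases hwv : w = v
      · subst hwv
        simp only [Function.update_of_ne huv, Function.update_self]
        rintro rfl
        exact hi (Finset.mem_image_of_mem c hu)
      · have : φ w ≠ n := fun h => hwv (hφ (h.trans hvn.symm))
        simp only [Function.update_of_ne huv, Function.update_of_ne hwv]
        exact hc w (by omega) u hu
    · refine ⟨c, fun v hv' => hc v ?_⟩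
      have : φ v ≠ n := fun h => hv ⟨v, h⟩
      omega

lemma two (hH : ∀ x y, A x y ∨ A y x → H.Adj x y) (hA : ∀ u v, A u v → ¬ A v u)
    (hφ : Function.Injective φ) (hc : Chord H φ) (hk : ∀ v, (Bk H φ S v).card ≤ 2) :
    ∃ Y ⊆ S, Acy A Y ∧ 3 * S.card ≤ 5 * Y.card := by
  classical
  obtain ⟨c, hcol⟩ := color3 hφ hk (S.sup φ + 1)
  have hcol' : ∀ v ∈ S, ∀ u ∈ Bk H φ S v, c u ≠ c v := fun v hv =>
    hcol v (Nat.lt_succ_of_le (Finset.le_sup hv))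
  have hac : ∀ i, Acy A (S.filter (fun x => c x ≠ i)) := by
    intro i
    refine forest hH hA hφ _ ?_
    intro v hv a ha b hb
    by_contra hab
    have ha' := mem_Bk.1 ha
    have hb' := mem_Bk.1 hb
    rw [Finset.mem_filter] at ha' hb' hv
    have hadj := hc v a b ha'.2.1 hb'.2.1 ha'.2.2 hb'.2.2 hab
    have e1 := hcol' v hv.1 a (mem_Bk.2 ⟨ha'.1.1, ha'.2⟩)
    have e2 := hcol' v hv.1 b (mem_Bk.2 ⟨hb'.1.1, hb'.2⟩)
    have e3 : c a ≠ c b := by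
      have : φ a ≠ φ b := fun h => hab (hφ h)
      rcases lt_or_gt_of_ne this with h | h
      · exact hcol' b hb'.1.1 a (mem_Bk.2 ⟨ha'.1.1, hadj.symm, h⟩)
      · exact (hcol' a ha'.1.1 b (mem_Bk.2 ⟨hb'.1.1, hadj, h⟩)).symm
    have e4 := hv.2
    have e5 := ha'.1.2
    have e6 := hb'.1.2
    omega
  have hsum : ∑ i : Fin 3, (S.filter (fun x => c x = i)).card = S.card :=
    (Finset.card_eq_sum_card_fiberwise (fun x _ => Finset.mem_coe.2 (Finset.mem_univ _))).symm
  rw [Fin.sum_univ_three] at hsum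
  have hcomp : ∀ i, (S.filter (fun x => c x = i)).card + (S.filter (fun x => c x ≠ i)).card
      = S.card := fun i => Finset.card_filter_add_card_filter_not _
  have : ∃ i, 3 * S.card ≤ 5 * (S.filter (fun x => c x ≠ i)).card := by
    by_contra hcon
    push Not at hcon
    have a0 := hcon 0
    have a1 := hcon 1
    have a2 := hcon 2
    have b0 := hcomp 0
    have b1 := hcomp 1
    have b2 := hcomp 2
    omega
  obtain ⟨i, hi⟩ := this
  exact ⟨_, Finset.filter_subset _ _, hac i, hi⟩

end red

end FVSProof

theorem stmt12 {V : Type*} [Fintype V] (k : ℕ) (hk : 1 ≤ k) (A : V → V → Prop)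
    (hA : ∀ u v, A u v → ¬ A v u)
    (htw : TreewidthLE (SimpleGraph.fromRel A) k) :
    (dirFvsNum A : ℚ) ≤ (k : ℚ) / ((k : ℚ) + 3) * Fintype.card V := by
  classical
  obtain ⟨H, ⟨e, he⟩, hle⟩ := htw
  set φ : V → ℕ := fun v => (e v : ℕ) with hφdef
  have hφ : Function.Injective φ := fun a b h => e.injective (Fin.ext h)
  have hH : ∀ x y, A x y ∨ A y x → H.Adj x y := by
    intro x y hxy
    apply hle
    rw [SimpleGraph.fromRel_adj]
    refine ⟨?_, hxy⟩
    rintro rfl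
    rcases hxy with h | h <;> exact hA _ _ h h
  have hc : FVSProof.Chord H φ := by
    intro v a b ha hb ha' hb' hab
    exact (he v).1 ⟨ha, ha'⟩ ⟨hb, hb'⟩ hab
  have hkB : ∀ S v, (FVSProof.Bk H φ S v).card ≤ k := by
    intro S v
    have h1 := (he v).2
    have h2 : ((FVSProof.Bk H φ S v : Finset V) : Set V) ⊆
        {u | H.Adj v u ∧ (e u : ℕ) < (e v : ℕ)} := fun u hu => (FVSProof.mem_Bk.1 hu).2
    have h3 := Set.ncard_le_ncard h2 (Set.toFinite _)
    rw [Set.ncard_coe_finset, h1] at h3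
    exact h3.trans (min_le_left _ _)
  have main : ∃ Y : Finset V, FVSProof.Acy A Y ∧ 3 * Fintype.card V ≤ (k + 3) * Y.card := by
    by_cases hk3 : 3 ≤ k
    · obtain ⟨Y, -, h1, h2⟩ := FVSProof.big_k hH hA hφ hc hk3 hkB _ Finset.univ rfl
      exact ⟨Y, h1, h2⟩
    · obtain rfl | rfl : k = 1 ∨ k = 2 := by omega
      · refine ⟨Finset.univ, FVSProof.forest hH hA hφ _ ?_, ?_⟩
        · intro v _ a ha b hb
          exact Finset.card_le_one.1 (hkB _ v) a ha b hb
        · rw [Finset.card_univ]; omega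
      · obtain ⟨Y, -, h1, h2⟩ := FVSProof.two (S := Finset.univ) hH hA hφ hc (hkB _)
        exact ⟨Y, h1, h2⟩
  obtain ⟨Y, ⟨f, hf⟩, hcard⟩ := main
  have hfvs : DirFVS A ((Yᶜ : Finset V) : Set V) := by
    intro v hv
    have : ∀ a b, Relation.TransGen (fun x y => x ∉ ((Yᶜ : Finset V) : Set V) ∧
        y ∉ ((Yᶜ : Finset V) : Set V) ∧ A x y) a b → f a < f b := by
      intro a b hab
      have step : ∀ x y, (x ∉ ((Yᶜ : Finset V) : Set V) ∧
        y ∉ ((Yᶜ : Finset V) : Set V) ∧ A x y) → f x < f y := by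
        rintro x y ⟨hx, hy, hxy⟩
        exact hf x (by simpa using hx) y (by simpa using hy) hxy
      induction hab with
      | single h => exact step _ _ h
      | tail _ h ih => exact ih.trans (step _ _ h)
    exact lt_irrefl _ (this v v hv)
  have hnum : dirFvsNum A ≤ (Yᶜ : Finset V).card :=
    Nat.sInf_le ⟨_, hfvs, Set.ncard_coe_finset _⟩
  have hY := Finset.card_add_card_compl Y
  have hfin : (k + 3) * dirFvsNum A ≤ k * Fintype.card V := by
    have : (k + 3) * dirFvsNum A ≤ (k + 3) * (Yᶜ : Finset V).card := Nat.mul_le_mul_left _ hnum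
    nlinarith
  have hfinQ : ((k : ℚ) + 3) * dirFvsNum A ≤ k * Fintype.card V := by exact_mod_cast hfin
  rw [div_mul_eq_mul_div, le_div_iff₀ (by positivity)]
  linarith
end
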